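/- arXiv:0910.3295 — 7 statements merged into one kernel-verified Lean document; each statement's English description precedes it below -/
import Mathlib

section
/- Let u1,u2,v1,v2,w1,w2 be unit vectors in ℂ² such that each of the pairs {u1,u2}, {v1,v2}, {w1,w2} is linearly independent, and let α1,α2 > 0. Suppose x1,x2,y1,y2,z1,z2 are unit vectors in ℂ² and β1,β2 > 0 satisfy β1·x1⊗y1⊗z1 + β2·x2⊗y2⊗z2 = α1·u1⊗v1⊗w1 + α2·u2⊗v2⊗w2 in ℂ²⊗ℂ²⊗ℂ². Then there is a permutation σ of {1,2} such that βi·xi⊗yi⊗zi = α_{σ(i)}·u_{σ(i)}⊗v_{σ(i)}⊗w_{σ(i)} for i = 1,2 (equality of the weighted rank-one tensors). In other words, the two-term product-state decomposition of a GHZ-class state is unique. -/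
noncomputable section

open scoped InnerProductSpace

/-- Tensor product of three vectors of `ℂ²`, realized inside
`EuclideanSpace ℂ (Fin 2 × Fin 2 × Fin 2)` (the three-qubit Hilbert space). -/
def tp3 (a b c : EuclideanSpace ℂ (Fin 2)) : EuclideanSpace ℂ (Fin 2 × Fin 2 × Fin 2) :=
  (WithLp.equiv 2 _).symm fun p => a p.1 * b p.2.1 * c p.2.2

/-- If a weighted sum of two product tensors over `K² ⊗ K² ⊗ K²` is diagonal with nonzero diagonal
entries, then each slice in the third factor, having rank one, involves only one of the terms. -/
theorem mul_eq_zero_of_sum_two_products_eq_diagonal {K : Type*} [Field K] {α β : Fin 2 → K}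
    {X Y Z : Fin 2 → Fin 2 → K} (hα : ∀ a, α a ≠ 0)
    (h : ∀ a b c, ∑ i, β i * (X i a * Y i b * Z i c) = if a = b ∧ b = c then α a else 0)
    (c : Fin 2) : Z 0 c * Z 1 c = 0 := by
  have slice_det (s t : K) : (s * Z 0 0 + t * Z 0 1) * (s * Z 1 0 + t * Z 1 1) *
      (β 0 * β 1 * (X 0 0 * X 1 1 - X 0 1 * X 1 0) * (Y 0 0 * Y 1 1 - Y 0 1 * Y 1 0)) =
      s * t * (α 0 * α 1) := by
    have entry (a b : Fin 2) := congrArg₂ (s * · + t * ·) (h a b 0) (h a b 1)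
    have h00 := entry 0 0
    have h01 := entry 0 1
    have h10 := entry 1 0
    have h11 := entry 1 1
    simp [Fin.sum_univ_two] at h00 h01 h10 h11
    linear_combination h00 * (s * (β 0 * (X 0 1 * Y 0 1 * Z 0 0) +
      β 1 * (X 1 1 * Y 1 1 * Z 1 0)) + t * (β 0 * (X 0 1 * Y 0 1 * Z 0 1) +
      β 1 * (X 1 1 * Y 1 1 * Z 1 1))) + s * α 0 * h11 - h01 * (s * (β 0 * (X 0 1 * Y 0 0 * Z 0 0) +
      β 1 * (X 1 1 * Y 1 0 * Z 1 0)) + t * (β 0 * (X 0 1 * Y 0 0 * Z 0 1) +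
      β 1 * (X 1 1 * Y 1 0 * Z 1 1)))
  have hdet : β 0 * β 1 * (X 0 0 * X 1 1 - X 0 1 * X 1 0) *
      (Y 0 0 * Y 1 1 - Y 0 1 * Y 1 0) ≠ 0 := by
    intro h0
    have h1 := slice_det 1 1
    rw [h0] at h1
    simp [hα] at h1
  refine (mul_eq_zero.mp ?_).resolve_right hdet
  fin_cases c
  · simpa using slice_det 1 0
  · simpa using slice_det 0 1

/-- If a weighted sum of two product tensors over `K² ⊗ K² ⊗ K²` is diagonal with nonzero diagonal
entries, then, up to a permutation, its two terms are the two diagonal terms. -/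
theorem exists_perm_of_sum_two_products_eq_diagonal {K : Type*} [Field K] {α β : Fin 2 → K}
    {X Y Z : Fin 2 → Fin 2 → K} (hα : ∀ a, α a ≠ 0)
    (h : ∀ a b c, ∑ i, β i * (X i a * Y i b * Z i c) = if a = b ∧ b = c then α a else 0) :
    ∃ σ : Equiv.Perm (Fin 2), ∀ i,
      β i * (X i (σ i) * Y i (σ i) * Z i (σ i)) = α (σ i) ∧
      ∀ a ≠ σ i, X i a = 0 ∧ Y i a = 0 ∧ Z i a = 0 := by
  have hZ := mul_eq_zero_of_sum_two_products_eq_diagonal hα h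
  have hY := mul_eq_zero_of_sum_two_products_eq_diagonal (β := β) (X := X) (Y := Z) (Z := Y) hα
    fun a b c => by
      have hacb := h a c b
      simp only [Fin.sum_univ_two] at hacb ⊢
      grind
  have hX := mul_eq_zero_of_sum_two_products_eq_diagonal (β := β) (X := Z) (Y := Y) (Z := X) hα
    fun a b c => by
      have hcba := h c b a
      simp only [Fin.sum_univ_two] at hcba ⊢
      grind
  have h000 := h 0 0 0
  have h001 := h 0 0 1
  have h010 := h 0 1 0
  have h100 := h 1 0 0
  have h111 := h 1 1 1
  have hα0 := hα 0
  simp [Fin.sum_univ_two] at h000 h001 h010 h100 h111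
  have hX0 := hX 0
  have hY0 := hY 0
  have hZ0 := hZ 0
  by_cases hx : X 0 0 = 0
  · refine ⟨Equiv.swap 0 1, ?_⟩
    simp [Fin.forall_fin_two]
    grind
  · refine ⟨1, ?_⟩
    simp [Fin.forall_fin_two]
    grind

theorem Module.Basis.eq_repr_smul_of_repr_eq_zero {ι R M : Type*} [Fintype ι] [Semiring R]
    [AddCommMonoid M] [Module R M] (b : Module.Basis ι R M) {m : M} {j : ι}
    (h : ∀ i ≠ j, b.repr m i = 0) : m = b.repr m j • b j := by
  conv_lhs => rw [← b.sum_repr m]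
  exact Fintype.sum_eq_single j fun i hi => by rw [h i hi, zero_smul]

theorem tp3_smul (r s t : ℂ) (a b c : EuclideanSpace ℂ (Fin 2)) :
    tp3 (r • a) (s • b) (t • c) = (r * s * t) • tp3 a b c := by
  ext p
  simp [tp3]
  ring

/-- Linear functionals on the three tensor factors induce one on the tensor product. -/
theorem exists_linearMap_tp3 (f g h : EuclideanSpace ℂ (Fin 2) →ₗ[ℂ] ℂ) :
    ∃ F : EuclideanSpace ℂ (Fin 2 × Fin 2 × Fin 2) →ₗ[ℂ] ℂ,
      ∀ a b c, F (tp3 a b c) = f a * g b * h c := by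
  have expand (f : EuclideanSpace ℂ (Fin 2) →ₗ[ℂ] ℂ) (a : EuclideanSpace ℂ (Fin 2)) :
      f a = ∑ p, a p * f (EuclideanSpace.single p 1) := by
    conv_lhs => rw [← (EuclideanSpace.basisFun (Fin 2) ℂ).sum_repr a]
    simp
  refine ⟨∑ p : Fin 2 × Fin 2 × Fin 2, (f (EuclideanSpace.single p.1 1) *
    g (EuclideanSpace.single p.2.1 1) * h (EuclideanSpace.single p.2.2 1)) •
    (EuclideanSpace.proj p).toLinearMap, fun a b c => ?_⟩
  rw [expand f, expand g, expand h]
  simp [tp3, Fintype.sum_prod_type, Fin.sum_univ_two]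
  ring

/-- **Uniqueness of the two-term product decomposition of a GHZ-class state.**
If `∑ i, βᵢ • xᵢ⊗yᵢ⊗zᵢ = ∑ i, αᵢ • uᵢ⊗vᵢ⊗wᵢ` where all local vectors are unit vectors,
the coefficients are positive, and each of the local pairs `{u₁,u₂}`, `{v₁,v₂}`, `{w₁,w₂}`
is linearly independent, then the two decompositions agree up to a permutation of the
two terms (as weighted rank-one tensors). -/
theorem ghz_class_two_term_decomposition_unique
    (u v w x y z : Fin 2 → EuclideanSpace ℂ (Fin 2)) (α β : Fin 2 → ℝ)
    (hu : ∀ i, ‖u i‖ = 1) (hv : ∀ i, ‖v i‖ = 1) (hw : ∀ i, ‖w i‖ = 1)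
    (hx : ∀ i, ‖x i‖ = 1) (hy : ∀ i, ‖y i‖ = 1) (hz : ∀ i, ‖z i‖ = 1)
    (hα : ∀ i, 0 < α i) (hβ : ∀ i, 0 < β i)
    (huLI : LinearIndependent ℂ u) (hvLI : LinearIndependent ℂ v)
    (hwLI : LinearIndependent ℂ w)
    (heq : ∑ i, (β i : ℂ) • tp3 (x i) (y i) (z i)
         = ∑ i, (α i : ℂ) • tp3 (u i) (v i) (w i)) :
    ∃ σ : Equiv.Perm (Fin 2), ∀ i,
      (β i : ℂ) • tp3 (x i) (y i) (z i)
        = (α (σ i) : ℂ) • tp3 (u (σ i)) (v (σ i)) (w (σ i)) := by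
  have exists_basis {t : Fin 2 → EuclideanSpace ℂ (Fin 2)} (ht : LinearIndependent ℂ t) :
      ∃ b : Module.Basis (Fin 2) ℂ (EuclideanSpace ℂ (Fin 2)), ⇑b = t :=
    ⟨basisOfLinearIndependentOfCardEqFinrank ht (by simp), by simp⟩
  obtain ⟨bu, rfl⟩ := exists_basis huLI
  obtain ⟨bv, rfl⟩ := exists_basis hvLI
  obtain ⟨bw, rfl⟩ := exists_basis hwLI
  have hdiag (a b c : Fin 2) :
      ∑ i, (β i : ℂ) * (bu.repr (x i) a * bv.repr (y i) b * bw.repr (z i) c) =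
        if a = b ∧ b = c then (α a : ℂ) else 0 := by
    obtain ⟨F, hF⟩ := exists_linearMap_tp3 (bu.coord a) (bv.coord b) (bw.coord c)
    have h := congrArg F heq
    simp only [map_sum, map_smul, hF, Module.Basis.coord_apply, smul_eq_mul,
      Module.Basis.repr_self, Finsupp.single_apply] at h
    rw [h, Fin.sum_univ_two]
    fin_cases a <;> fin_cases b <;> fin_cases c <;> simp
  obtain ⟨σ, hσ⟩ := exists_perm_of_sum_two_products_eq_diagonal
    (X := fun i => bu.repr (x i)) (Y := fun i => bv.repr (y i)) (Z := fun i => bw.repr (z i))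
    (fun a => Complex.ofReal_ne_zero.mpr (hα a).ne') hdiag
  refine ⟨σ, fun i => ?_⟩
  obtain ⟨hcoeff, hzero⟩ := hσ i
  have hxi := bu.eq_repr_smul_of_repr_eq_zero fun a ha => (hzero a ha).1
  have hyi := bv.eq_repr_smul_of_repr_eq_zero fun a ha => (hzero a ha).2.1
  have hzi := bw.eq_repr_smul_of_repr_eq_zero fun a ha => (hzero a ha).2.2
  rw [← hcoeff, mul_smul, ← tp3_smul, ← hxi, ← hyi, ← hzi]
end
end

section
/- Let ψ = α1·T1 + α2·T2 and ψ' = α1'·T1' + α2'·T2' be GHZ-class states in ℂ²⊗ℂ²⊗ℂ², where T1 = u1⊗v1⊗w1, T2 = u2⊗v2⊗w2, T1' = u1'⊗v1'⊗w1', T2' = u2'⊗v2'⊗w2' are products of unit vectors, α1,α2,α1',α2' > 0, and each local pair ({u1,u2}, {v1,v2}, {w1,w2}, {u1',u2'}, {v1',v2'}, {w1',w2'}) is linearly independent. If O = A⊗B⊗C is a product operator and o ∈ ℂ, o ≠ 0, satisfy O ψ = o ψ', then either (O(α1·T1) = o·α1'·T1' and O(α2·T2) = o·α2'·T2') or (O(α1·T1)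 = o·α2'·T2' and O(α2·T2) = o·α1'·T1'). -/
noncomputable section

/-- The product operator `A ⊗ B ⊗ C` on the three-qubit Hilbert space, as a matrix. -/
def kron3 (A B C : Matrix (Fin 2) (Fin 2) ℂ) :
    Matrix (Fin 2 × Fin 2 × Fin 2) (Fin 2 × Fin 2 × Fin 2) ℂ :=
  fun p q => A p.1 q.1 * B p.2.1 q.2.1 * C p.2.2 q.2.2

/-- If a sum of two product tensors is diagonal with nonzero diagonal, then in each slot every
coordinate vanishes for one of the two factors (stated for the last slot). -/
lemma mul_eq_zero_of_diagonal {a b c : Fin 2 → Fin 2 → ℂ} {X : Fin 2 → ℂ} (hX : ∀ j, X j ≠ 0)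
    (h : ∀ j k l, a 0 j * b 0 k * c 0 l + a 1 j * b 1 k * c 1 l
      = if j = k ∧ j = l then X j else 0) (l : Fin 2) :
    c 0 l * c 1 l = 0 := by
  have h000 := h 0 0 0
  have h001 := h 0 0 1
  have h010 := h 0 1 0
  have h011 := h 0 1 1
  have h100 := h 1 0 0
  have h101 := h 1 0 1
  have h110 := h 1 1 0
  have h111 := h 1 1 1
  simp at h000 h001 h010 h011 h100 h101 h110 h111
  set d := (a 0 0 * a 1 1 - a 0 1 * a 1 0) * (b 0 0 * b 1 1 - b 0 1 * b 1 0) with hd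
  have hdX : d * ((c 0 0 + c 0 1) * (c 1 0 + c 1 1)) = X 0 * X 1 := by
    have e00 : a 0 0 * b 0 0 * (c 0 0 + c 0 1) + a 1 0 * b 1 0 * (c 1 0 + c 1 1) = X 0 := by
      linear_combination h000 + h001
    have e11 : a 0 1 * b 0 1 * (c 0 0 + c 0 1) + a 1 1 * b 1 1 * (c 1 0 + c 1 1) = X 1 := by
      linear_combination h110 + h111
    have e01 : a 0 0 * b 0 1 * (c 0 0 + c 0 1) + a 1 0 * b 1 1 * (c 1 0 + c 1 1) = 0 := by
      linear_combination h010 + h011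
    have e10 : a 0 1 * b 0 0 * (c 0 0 + c 0 1) + a 1 1 * b 1 0 * (c 1 0 + c 1 1) = 0 := by
      linear_combination h100 + h101
    rw [← e00, ← e11]
    linear_combination (-(a 0 1 * b 0 0 * (c 0 0 + c 0 1) + a 1 1 * b 1 0 * (c 1 0 + c 1 1))) * e01
  have hd0 : d ≠ 0 := by
    intro h0
    rw [h0, zero_mul] at hdX
    exact mul_ne_zero (hX 0) (hX 1) hdX.symm
  have key : d * (c 0 l * c 1 l) = 0 := by
    have e : d * (c 0 l * c 1 l)
        = (a 0 0 * b 0 0 * c 0 l + a 1 0 * b 1 0 * c 1 l)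
            * (a 0 1 * b 0 1 * c 0 l + a 1 1 * b 1 1 * c 1 l)
          - (a 0 0 * b 0 1 * c 0 l + a 1 0 * b 1 1 * c 1 l)
            * (a 0 1 * b 0 0 * c 0 l + a 1 1 * b 1 0 * c 1 l) := by
      rw [hd]; ring
    rw [e, h, h, h, h]
    fin_cases l <;> simp
  exact (mul_eq_zero.mp key).resolve_left hd0

/-- If a sum of two product tensors is diagonal with nonzero diagonal, and the first summand has
nonzero first diagonal entry, then the summands are the two diagonal terms, in order. -/
lemma terms_of_diagonal {a b c : Fin 2 → Fin 2 → ℂ} {X : Fin 2 → ℂ} (hX : ∀ j, X j ≠ 0)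
    (h : ∀ j k l, a 0 j * b 0 k * c 0 l + a 1 j * b 1 k * c 1 l
      = if j = k ∧ j = l then X j else 0)
    (h0 : a 0 0 * b 0 0 * c 0 0 ≠ 0) (i j k l : Fin 2) :
    a i j * b i k * c i l = if i = j ∧ i = k ∧ i = l then X i else 0 := by
  have hc := mul_eq_zero_of_diagonal hX h 0
  have hb := mul_eq_zero_of_diagonal (a := c) (b := a) (c := b) hX
    (fun j k l => by
      have := h k l j
      rw [show c 0 j * a 0 k * b 0 l + c 1 j * a 1 k * b 1 l
        = a 0 k * b 0 l * c 0 j + a 1 k * b 1 l * c 1 j by ring, this]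
      fin_cases j <;> fin_cases k <;> fin_cases l <;> simp) 0
  have ha := mul_eq_zero_of_diagonal (a := b) (b := c) (c := a) hX
    (fun j k l => by
      have := h l j k
      rw [show b 0 j * c 0 k * a 0 l + b 1 j * c 1 k * a 1 l
        = a 0 l * b 0 j * c 0 k + a 1 l * b 1 j * c 1 k by ring, this]
      fin_cases j <;> fin_cases k <;> fin_cases l <;> simp) 0
  have c00 : c 0 0 ≠ 0 := right_ne_zero_of_mul h0
  have b00 : b 0 0 ≠ 0 := right_ne_zero_of_mul (left_ne_zero_of_mul h0)
  have a00 : a 0 0 ≠ 0 := left_ne_zero_of_mul (left_ne_zero_of_mul h0)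
  have c10 : c 1 0 = 0 := (mul_eq_zero.mp hc).resolve_left c00
  have b10 : b 1 0 = 0 := (mul_eq_zero.mp hb).resolve_left b00
  have a10 : a 1 0 = 0 := (mul_eq_zero.mp ha).resolve_left a00
  have c01 : c 0 1 = 0 := by simpa [a00, b00, a10] using h 0 0 1
  have b01 : b 0 1 = 0 := by simpa [a00, c00, a10] using h 0 1 0
  have a01 : a 0 1 = 0 := by simpa [b00, c00, b10] using h 1 0 0
  have e0 : a 0 0 * b 0 0 * c 0 0 = X 0 := by simpa [a10] using h 0 0 0
  have e1 : a 1 1 * b 1 1 * c 1 1 = X 1 := by simpa [a01] using h 1 1 1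
  fin_cases i <;> fin_cases j <;> fin_cases k <;> fin_cases l <;> simp [*]

lemma tp3_apply (a b c : EuclideanSpace ℂ (Fin 2)) (p : Fin 2 × Fin 2 × Fin 2) :
    tp3 a b c p = a p.1 * b p.2.1 * c p.2.2 := rfl

lemma kron3_tp3 (A B C : Matrix (Fin 2) (Fin 2) ℂ) (a b c : EuclideanSpace ℂ (Fin 2)) :
    Matrix.toEuclideanLin (kron3 A B C) (tp3 a b c)
      = tp3 (Matrix.toEuclideanLin A a) (Matrix.toEuclideanLin B b)
          (Matrix.toEuclideanLin C c) := by
  ext p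
  simp only [tp3_apply, Matrix.toLpLin_apply, Matrix.mulVec, dotProduct, kron3,
    Fintype.sum_prod_type, Fin.sum_univ_two]
  ring

/-- Two linearly independent vectors of `ℂ²` are the image of the standard basis under an
invertible matrix. -/
lemma exists_matrix_mapping_single {u : Fin 2 → EuclideanSpace ℂ (Fin 2)}
    (hu : LinearIndependent ℂ u) :
    ∃ M N : Matrix (Fin 2) (Fin 2) ℂ,
      (∀ x, Matrix.toEuclideanLin M (Matrix.toEuclideanLin N x) = x) ∧
      (∀ i, Matrix.toEuclideanLin M (EuclideanSpace.single i 1) = u i) ∧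
      ∀ i, Matrix.toEuclideanLin N (u i) = EuclideanSpace.single i 1 := by
  let b := basisOfLinearIndependentOfCardEqFinrank hu (by simp)
  let e := b.equiv (EuclideanSpace.basisFun (Fin 2) ℂ).toBasis (Equiv.refl _)
  refine ⟨Matrix.toEuclideanLin.symm e.symm.toLinearMap, Matrix.toEuclideanLin.symm e.toLinearMap,
    ?_, ?_, ?_⟩
  · intro x
    simp
  · intro i
    rw [LinearEquiv.apply_symm_apply, LinearEquiv.coe_coe, LinearEquiv.symm_apply_eq]
    simpa [b] using (b.equiv_apply i (EuclideanSpace.basisFun (Fin 2) ℂ).toBasis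
      (Equiv.refl _)).symm
  · intro i
    rw [LinearEquiv.apply_symm_apply, LinearEquiv.coe_coe]
    simpa [b] using b.equiv_apply i (EuclideanSpace.basisFun (Fin 2) ℂ).toBasis (Equiv.refl _)

/-- The branch structure for a sum of two product vectors equal to a diagonal vector. -/
lemma tp3_terms_of_sum_eq_diagonal (a b c : Fin 2 → EuclideanSpace ℂ (Fin 2)) (α X : Fin 2 → ℂ)
    (hX : ∀ i, X i ≠ 0)
    (h : ∑ i, α i • tp3 (a i) (b i) (c i) = ∑ i, X i • tp3 (EuclideanSpace.single i 1)
      (EuclideanSpace.single i 1) (EuclideanSpace.single i 1)) :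
    ∃ σ : Equiv.Perm (Fin 2), (σ = 1 ∨ σ = Equiv.swap 0 1) ∧
      ∀ i, α i • tp3 (a i) (b i) (c i) = X (σ i) • tp3 (EuclideanSpace.single (σ i) 1)
        (EuclideanSpace.single (σ i) 1) (EuclideanSpace.single (σ i) 1) := by
  have hs (j k l : Fin 2) : α 0 * a 0 j * b 0 k * c 0 l + α 1 * a 1 j * b 1 k * c 1 l
      = if j = k ∧ j = l then X j else 0 := by
    have := congrArg (fun x : EuclideanSpace ℂ (Fin 2 × Fin 2 × Fin 2) => x (j, k, l)) h
    simp only [Fin.sum_univ_two, PiLp.add_apply, PiLp.smul_apply, tp3_apply, smul_eq_mul] at this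
    rw [show α 0 * a 0 j * b 0 k * c 0 l + α 1 * a 1 j * b 1 k * c 1 l
      = α 0 * (a 0 j * b 0 k * c 0 l) + α 1 * (a 1 j * b 1 k * c 1 l) by ring, this]
    fin_cases j <;> fin_cases k <;> fin_cases l <;> simp
  by_cases h0 : α 0 * a 0 0 * b 0 0 * c 0 0 = 0
  · have h1 : α 1 * a 1 0 * b 1 0 * c 1 0 ≠ 0 := by
      have := hs 0 0 0
      rw [h0, zero_add] at this
      simpa [this] using hX 0
    have ht := terms_of_diagonal (a := fun i j => α (Equiv.swap 0 1 i) * a (Equiv.swap 0 1 i) j)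
      (b := fun i k => b (Equiv.swap 0 1 i) k) (c := fun i l => c (Equiv.swap 0 1 i) l) hX
      (fun j k l => by simpa [add_comm] using hs j k l) (by simpa using h1)
    refine ⟨Equiv.swap 0 1, Or.inr rfl, fun i => ?_⟩
    ext ⟨j, k, l⟩
    have := ht (Equiv.swap 0 1 i) j k l
    simp only [Equiv.swap_apply_self] at this
    simp only [PiLp.smul_apply, tp3_apply, smul_eq_mul, ← mul_assoc]
    rw [this]
    fin_cases i <;> fin_cases j <;> fin_cases k <;> fin_cases l <;> simp
  · refine ⟨1, Or.inl rfl, fun i => ?_⟩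
    ext ⟨j, k, l⟩
    simp only [PiLp.smul_apply, tp3_apply, smul_eq_mul, ← mul_assoc]
    rw [terms_of_diagonal (a := fun i j => α i * a i j) (b := fun i k => b i k)
      (c := fun i l => c i l) hX hs h0 i j k l]
    fin_cases i <;> fin_cases j <;> fin_cases k <;> fin_cases l <;> simp

/-- **Lemma 2 (branch structure of successful LOCC operations within the GHZ class).**
If a product operator `O = A ⊗ B ⊗ C` maps a GHZ-class state
`ψ = α₁ T₁ + α₂ T₂` to `o • ψ'` with `ψ' = α₁' T₁' + α₂' T₂'` a GHZ-class state and
`o ≠ 0`, then either `O` maps the weighted product term `αᵢ Tᵢ` to `o • (αᵢ' Tᵢ')` for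
`i = 1, 2`, or it maps them to the swapped terms. -/
theorem locc_branch_term_mapping
    (u v w u' v' w' : Fin 2 → EuclideanSpace ℂ (Fin 2)) (α α' : Fin 2 → ℝ)
    (hu : ∀ i, ‖u i‖ = 1) (hv : ∀ i, ‖v i‖ = 1) (hw : ∀ i, ‖w i‖ = 1)
    (hu' : ∀ i, ‖u' i‖ = 1) (hv' : ∀ i, ‖v' i‖ = 1) (hw' : ∀ i, ‖w' i‖ = 1)
    (hα : ∀ i, 0 < α i) (hα' : ∀ i, 0 < α' i)
    (huLI : LinearIndependent ℂ u) (hvLI : LinearIndependent ℂ v)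
    (hwLI : LinearIndependent ℂ w)
    (huLI' : LinearIndependent ℂ u') (hvLI' : LinearIndependent ℂ v')
    (hwLI' : LinearIndependent ℂ w')
    (A B C : Matrix (Fin 2) (Fin 2) ℂ) (o : ℂ) (ho : o ≠ 0)
    (hmap : Matrix.toEuclideanLin (kron3 A B C)
        (∑ i, (α i : ℂ) • tp3 (u i) (v i) (w i))
      = o • ∑ i, (α' i : ℂ) • tp3 (u' i) (v' i) (w' i)) :
    (∀ i : Fin 2, Matrix.toEuclideanLin (kron3 A B C) ((α i : ℂ) • tp3 (u i) (v i) (w i))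
        = o • ((α' i : ℂ) • tp3 (u' i) (v' i) (w' i)))
    ∨ (∀ i : Fin 2, Matrix.toEuclideanLin (kron3 A B C) ((α i : ℂ) • tp3 (u i) (v i) (w i))
        = o • ((α' (Equiv.swap 0 1 i) : ℂ)
            • tp3 (u' (Equiv.swap 0 1 i)) (v' (Equiv.swap 0 1 i)) (w' (Equiv.swap 0 1 i)))) := by
  obtain ⟨M₁, N₁, hMN₁, hM₁, hN₁⟩ := exists_matrix_mapping_single huLI'
  obtain ⟨M₂, N₂, hMN₂, hM₂, hN₂⟩ := exists_matrix_mapping_single hvLI'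
  obtain ⟨M₃, N₃, hMN₃, hM₃, hN₃⟩ := exists_matrix_mapping_single hwLI'
  have h := congrArg (Matrix.toEuclideanLin (kron3 N₁ N₂ N₃)) hmap
  simp only [Finset.smul_sum, map_sum, map_smul, kron3_tp3, hN₁, hN₂, hN₃] at h
  simp only [smul_smul] at h
  obtain ⟨σ, hσ, hT⟩ := tp3_terms_of_sum_eq_diagonal _ _ _ (fun i => (α i : ℂ))
    (fun i => o * (α' i : ℂ))
    (fun i => mul_ne_zero ho (Complex.ofReal_ne_zero.mpr (hα' i).ne')) h
  have hO (i : Fin 2) :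
      Matrix.toEuclideanLin (kron3 A B C) ((α i : ℂ) • tp3 (u i) (v i) (w i))
        = o • ((α' (σ i) : ℂ) • tp3 (u' (σ i)) (v' (σ i)) (w' (σ i))) := by
    have := congrArg (Matrix.toEuclideanLin (kron3 M₁ M₂ M₃)) (hT i)
    simp only [map_smul, kron3_tp3, hMN₁, hMN₂, hMN₃, hM₁, hM₂, hM₃] at this
    rw [map_smul, kron3_tp3, this, smul_smul]
  rcases hσ with rfl | rfl
  · exact Or.inl hO
  · exact Or.inr hO
end
end

section
/- Maximal 3-tangle at fixed interference term (Theorem 5): for all δ ∈ (0, π/4], α, β, γ ∈ (0, π/2], and φ ∈ [0, 2π), writing t = 2·cos α·cos β·cos γ·sin δ·cos δ·cos φ, one has 4·sin²α·sin²β·sin²γ·sin²δ·cos²δ ≤ (1 − (t²)^{1/3})³. Equivalently, dividing both sides by (1+t)², the 3-tangle τ = 4 sin²α sin²β sin²γ sin²δ cos²δ/(1+t)² of a GHZ-class state with interference term I = t/(1+t) satisfies τ ≤ (1−a²)³/(1+a³)², where a is the real cube root of I/(1−I). -/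
open Real

/-- Hölder's inequality for three factors `(1 - a ^ 3) + a ^ 3`, in polynomial form. -/
lemma prod_one_sub_cube_le {a b c : ℝ} (ha : 0 ≤ a) (hb : 0 ≤ b) (hc : 0 ≤ c)
    (ha' : a ≤ 1) (hb' : b ≤ 1) (hc' : c ≤ 1) :
    (1 - a ^ 3) * (1 - b ^ 3) * (1 - c ^ 3) ≤ (1 - a * b * c) ^ 3 := by
  have hsum : a * b + b * c + c * a ≤ a + b + c := by nlinarith
  have hsq : ∀ {u : ℝ} (v : ℝ), 0 ≤ u → u ≤ 1 → u ^ 2 * v ^ 2 ≤ v ^ 2 := fun v h h' =>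
    mul_le_of_le_one_left (sq_nonneg v) (pow_le_one₀ h h')
  have hmul : (a * b + b * c + c * a) *
        (c ^ 2 * (a - b) ^ 2 + a ^ 2 * (b - c) ^ 2 + b ^ 2 * (c - a) ^ 2)
      ≤ (a + b + c) * ((a - b) ^ 2 + (b - c) ^ 2 + (c - a) ^ 2) :=
    mul_le_mul hsum
      (add_le_add (add_le_add (hsq _ hc hc') (hsq _ ha ha')) (hsq _ hb hb'))
      (by positivity) (by positivity)
  linarith

lemma prod_one_sub_le_rpow {x y z : ℝ} (hx : 0 ≤ x) (hy : 0 ≤ y) (hz : 0 ≤ z)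
    (hx' : x ≤ 1) (hy' : y ≤ 1) (hz' : z ≤ 1) :
    (1 - x) * (1 - y) * (1 - z) ≤ (1 - (x * y * z) ^ ((1 : ℝ) / 3)) ^ 3 := by
  have hcube : ∀ {u : ℝ}, 0 ≤ u → (u ^ ((1 : ℝ) / 3)) ^ 3 = u := fun h => by
    rw [← rpow_natCast, ← rpow_mul h]; norm_num
  have hle : ∀ {u : ℝ}, 0 ≤ u → u ≤ 1 → u ^ ((1 : ℝ) / 3) ≤ 1 := fun h h' =>
    rpow_le_one h h' (by norm_num)
  have h := prod_one_sub_cube_le (rpow_nonneg hx (1 / 3)) (rpow_nonneg hy (1 / 3))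
    (rpow_nonneg hz (1 / 3)) (hle hx hx') (hle hy hy') (hle hz hz')
  rwa [hcube hx, hcube hy, hcube hz, ← mul_rpow hx hy, ← mul_rpow (mul_nonneg hx hy) hz] at h

/-- **Theorem 5 (maximal 3-tangle at fixed interference term).**
For `δ ∈ (0, π/4]`, `α, β, γ ∈ (0, π/2]`, `φ ∈ [0, 2π)` and
`t = 2 cos α cos β cos γ sin δ cos δ cos φ`, one has
`4 sin²α sin²β sin²γ sin²δ cos²δ ≤ (1 − (t²)^{1/3})³`. Dividing by `(1+t)²`, this says
that the 3-tangle of a GHZ-class state with interference term `I = t/(1+t)` is at most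
`(1−a²)³/(1+a³)²` where `a` is the real cube root of `I/(1−I)`. -/
theorem max_three_tangle_at_fixed_interference
    (δ α β γ φ t : ℝ)
    (hδ : δ ∈ Set.Ioc 0 (π / 4))
    (hα : α ∈ Set.Ioc 0 (π / 2)) (hβ : β ∈ Set.Ioc 0 (π / 2))
    (hγ : γ ∈ Set.Ioc 0 (π / 2)) (hφ : φ ∈ Set.Ico 0 (2 * π))
    (ht : t = 2 * cos α * cos β * cos γ * sin δ * cos δ * cos φ) :
    4 * sin α ^ 2 * sin β ^ 2 * sin γ ^ 2 * sin δ ^ 2 * cos δ ^ 2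
      ≤ (1 - (t ^ 2) ^ ((1 : ℝ) / 3)) ^ 3 := by
  have hk : sin (2 * δ) ^ 2 ≤ 1 := sin_sq_le_one _
  have ht_le : t ^ 2 ≤ cos α ^ 2 * cos β ^ 2 * cos γ ^ 2 :=
    calc t ^ 2 = cos α ^ 2 * cos β ^ 2 * cos γ ^ 2 * (sin (2 * δ) ^ 2 * cos φ ^ 2) := by
          rw [ht, sin_two_mul]; ring
      _ ≤ cos α ^ 2 * cos β ^ 2 * cos γ ^ 2 :=
          mul_le_of_le_one_right (by positivity)
            (mul_le_one₀ hk (sq_nonneg _) (cos_sq_le_one _))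
  calc 4 * sin α ^ 2 * sin β ^ 2 * sin γ ^ 2 * sin δ ^ 2 * cos δ ^ 2
      = sin (2 * δ) ^ 2 * (sin α ^ 2 * sin β ^ 2 * sin γ ^ 2) := by
        rw [sin_two_mul]; ring
    _ ≤ sin α ^ 2 * sin β ^ 2 * sin γ ^ 2 := mul_le_of_le_one_left (by positivity) hk
    _ ≤ (1 - (cos α ^ 2 * cos β ^ 2 * cos γ ^ 2) ^ ((1 : ℝ) / 3)) ^ 3 := by
        simp only [sin_sq]
        exact prod_one_sub_le_rpow (sq_nonneg _) (sq_nonneg _) (sq_nonneg _)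
          (cos_sq_le_one _) (cos_sq_le_one _) (cos_sq_le_one _)
    _ ≤ (1 - (t ^ 2) ^ ((1 : ℝ) / 3)) ^ 3 := by
        refine (Odd.strictMono_pow (by decide)).monotone (sub_le_sub_left ?_ 1)
        exact rpow_le_rpow (sq_nonneg t) ht_le (by norm_num)
end

section
/- Lower bound for conversion from |GHZ⟩ (four-step method): let a1, a2, b1, b2, c1, c2 be unit vectors in ℂ² with real inner products ⟨a1,a2⟩ = λ_a, ⟨b1,b2⟩ = λ_b, ⟨c1,c2⟩ = λ_c, all in [0,1], let α, β > 0 with α² + β² = 1, and let ψ = γ·(α·a1⊗b1⊗c1 + β·a2⊗b2⊗c2) with γ = (1 + 2αβλ_aλ_bλ_c)^{−1/2}, so ‖ψ‖ = 1. Then there exists a complete product family {O_i}_{i∈F} on ℂ²⊗ℂ²⊗ℂ² and a subset S ⊆ F such that O_i|GHZ⟩ is a complex scalar multiple of ψ for every i ∈ S and ∑_{i∈S} ‖O_i|GHZ⟩‖² ≥ (1 + 2αβλ_aλ_bλ_c)/(1 + λ_m), where λ_m = min(λ_a, λ_b, λ_c). -/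
noncomputable section

open scoped InnerProductSpace
open Matrix

/-- The computational basis vector `|i⟩` of `ℂ²`. -/
def ket (i : Fin 2) : EuclideanSpace ℂ (Fin 2) := EuclideanSpace.single i 1

/-- The GHZ state `(|000⟩ + |111⟩)/√2`. -/
def GHZ : EuclideanSpace ℂ (Fin 2 × Fin 2 × Fin 2) :=
  (Real.sqrt 2 : ℂ)⁻¹ • (tp3 (ket 0) (ket 0) (ket 0) + tp3 (ket 1) (ket 1) (ket 1))

/-- Gram relations of a pair of unit vectors with real overlap `lam`. -/
def HasOverlap (v : Fin 2 → EuclideanSpace ℂ (Fin 2)) (lam : ℝ) : Prop :=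
  ∀ j l, ∑ i, star (v j i) * v l i = if j = l then 1 else (lam : ℂ)

lemma hasOverlap_of_inner {v w : EuclideanSpace ℂ (Fin 2)} {lam : ℝ} (hv : ‖v‖ = 1)
    (hw : ‖w‖ = 1) (h : ⟪v, w⟫_ℂ = (lam : ℂ)) : HasOverlap ![v, w] lam := by
  have key (x y : EuclideanSpace ℂ (Fin 2)) : ∑ i, star (x i) * y i = ⟪x, y⟫_ℂ := by
    simp [PiLp.inner_apply, mul_comm]
  have h' : ⟪w, v⟫_ℂ = (lam : ℂ) := by
    rw [← inner_conj_symm, h, Complex.conj_ofReal]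
  intro j l
  rw [key]
  fin_cases j <;> fin_cases l <;> simp [h, h', inner_self_eq_norm_sq_to_K, hv, hw]

/-- The sign `(-1)^(s j)`. -/
def phase (s j : Fin 2) : ℂ := if s = 1 ∧ j = 1 then -1 else 1

lemma phase_add_mul (s r j : Fin 2) : phase (s + r) j * phase s j * phase r j = 1 := by
  fin_cases s <;> fin_cases r <;> fin_cases j <;> simp [phase]

/-- The map sending `|j⟩` to `± v (j + k) / √2`: a bit flip and a phase flip, followed by the
map with columns `v`. -/
def flipOp (v : Fin 2 → EuclideanSpace ℂ (Fin 2)) (k s : Fin 2) : Matrix (Fin 2) (Fin 2) ℂ :=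
  fun i j => (Real.sqrt 2 : ℂ)⁻¹ * v (j + k) i * phase s (j + k)

/-- The two-outcome measurement attempting to apply the map with columns `v`, preceded by
the diagonal map with entries `d`, a bit flip and a phase flip; outcome `0` is success. -/
def attemptOp (v : Fin 2 → EuclideanSpace ℂ (Fin 2)) (lam : ℝ) (d : Fin 2 → ℝ)
    (k s f : Fin 2) : Matrix (Fin 2) (Fin 2) ℂ :=
  fun i j => (Real.sqrt (1 + lam) : ℂ)⁻¹ * d (j + k) * phase s (j + k) *
    (if f = 0 then v (j + k) i
      else if i = 0 then (Real.sqrt lam : ℂ) * (if j + k = 0 then 1 else -1) else 0)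

lemma ofReal_sqrt_mul_self {x : ℝ} (hx : 0 ≤ x) :
    (Real.sqrt x : ℂ) * (Real.sqrt x : ℂ) = (x : ℂ) := by
  rw [← Complex.ofReal_mul, Real.mul_self_sqrt hx]

lemma ofReal_sqrt_inv_mul_self {x : ℝ} (hx : 0 ≤ x) :
    (Real.sqrt x : ℂ)⁻¹ * (Real.sqrt x : ℂ)⁻¹ = (x : ℂ)⁻¹ := by
  rw [← mul_inv, ofReal_sqrt_mul_self hx]

lemma star_phase (s j : Fin 2) : star (phase s j) = phase s j := by
  unfold phase; split_ifs <;> simp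

lemma flipOp_gram {v : Fin 2 → EuclideanSpace ℂ (Fin 2)} {lam : ℝ} (hv : HasOverlap v lam)
    (k s : Fin 2) (p q : Fin 2) :
    ((flipOp v k s)ᴴ * flipOp v k s) p q =
      2⁻¹ * (phase s (p + k) * phase s (q + k) * if p = q then 1 else (lam : ℂ)) := by
  have h := hv (p + k) (q + k)
  have h2 := ofReal_sqrt_inv_mul_self (x := 2) (by norm_num)
  simp only [add_left_inj] at h
  rw [← h, Matrix.mul_apply, Finset.mul_sum, Finset.mul_sum]
  refine Finset.sum_congr rfl fun i _ => ?_
  simp only [Matrix.conjTranspose_apply, flipOp, star_mul', star_phase, star_inv₀,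
    Complex.star_def, Complex.conj_ofReal]
  push_cast at h2
  rw [← h2]
  ring

lemma sum_flipOp_gram {v : Fin 2 → EuclideanSpace ℂ (Fin 2)} {lam : ℝ} (hv : HasOverlap v lam)
    (k : Fin 2) (p q : Fin 2) :
    ∑ s, ((flipOp v k s)ᴴ * flipOp v k s) p q = if p = q then 1 else 0 := by
  simp only [flipOp_gram hv]
  fin_cases k <;> fin_cases p <;> fin_cases q <;> norm_num [phase]

lemma sum_attemptOp_gram {v : Fin 2 → EuclideanSpace ℂ (Fin 2)} {lam : ℝ}
    (hv : HasOverlap v lam) (hlam : 0 ≤ lam) (d : Fin 2 → ℝ) (k s : Fin 2) (p q : Fin 2) :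
    ∑ f, ((attemptOp v lam d k s f)ᴴ * attemptOp v lam d k s f) p q =
      if p = q then ((d (p + k) : ℂ)) ^ 2 else 0 := by
  have h2 := ofReal_sqrt_inv_mul_self (x := 1 + lam) (by linarith)
  have h3 := ofReal_sqrt_mul_self hlam
  have hne : (1 + lam : ℂ) ≠ 0 := by
    exact_mod_cast (by linarith : (1 + lam : ℝ) ≠ 0)
  push_cast at h2
  have h := hv (p + k) (q + k)
  simp only [add_left_inj] at h
  have hp : phase s (p + k) * phase s (p + k) = 1 := by
    unfold phase; split_ifs <;> simp
  have hsum : ∑ f, ((attemptOp v lam d k s f)ᴴ * attemptOp v lam d k s f) p q =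
      (1 + lam : ℂ)⁻¹ * d (p + k) * d (q + k) * (phase s (p + k) * phase s (q + k)) *
        ((if p = q then 1 else (lam : ℂ)) + (Real.sqrt lam * Real.sqrt lam) * ((if p + k = 0 then 1 else -1) *
          (if q + k = 0 then 1 else -1))) := by
    rw [← h, ← h2]
    simp only [Matrix.mul_apply, Fin.sum_univ_two, Matrix.conjTranspose_apply, attemptOp,
      star_mul', star_phase, star_inv₀, Complex.star_def, Complex.conj_ofReal]
    clear h h2 h3 hne hp
    split_ifs <;> simp_all <;> ring
  rw [hsum, h3]
  by_cases hpq : p = q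
  · subst hpq
    rw [hp]
    simp only [if_true]
    have : (if p + k = 0 then (1 : ℂ) else -1) * (if p + k = 0 then 1 else -1) = 1 := by
      split_ifs <;> simp
    rw [this]
    field_simp
  · have : (if p + k = 0 then (1 : ℂ) else -1) * (if q + k = 0 then 1 else -1) = -1 := by
      fin_cases p <;> fin_cases q <;> fin_cases k <;> simp_all
    rw [this]
    simp [hpq]

/-- The matrix entries, on three separate factors, of the completeness relation. -/
lemma sum_gram_eq {v b c : Fin 2 → EuclideanSpace ℂ (Fin 2)} {lam lamB lamC : ℝ}
    (hv : HasOverlap v lam) (hb : HasOverlap b lamB) (hc : HasOverlap c lamC)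
    (hlam : 0 ≤ lam) {d : Fin 2 → ℝ} (hd : d 0 ^ 2 + d 1 ^ 2 = 1) (p q x y z w : Fin 2) :
    ∑ i : Fin 2 × Fin 2 × Fin 2 × Fin 2,
      ((attemptOp v lam d i.1 (i.2.1 + i.2.2.1) i.2.2.2)ᴴ *
        attemptOp v lam d i.1 (i.2.1 + i.2.2.1) i.2.2.2) p q *
      ((flipOp b i.1 i.2.1)ᴴ * flipOp b i.1 i.2.1) x y *
      ((flipOp c i.1 i.2.2.1)ᴴ * flipOp c i.1 i.2.2.1) z w =
    (if p = q then 1 else 0) * (if x = y then 1 else 0) * (if z = w then 1 else 0) := by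
  simp only [Fintype.sum_prod_type, ← Finset.sum_mul, sum_attemptOp_gram hv hlam,
    ← Finset.mul_sum, sum_flipOp_gram hb, sum_flipOp_gram hc]
  have hd' : (d 0 : ℂ) ^ 2 + (d 1 : ℂ) ^ 2 = 1 := by exact_mod_cast hd
  congr 2
  split_ifs with h
  · fin_cases p <;> simp [Fin.sum_univ_two, hd', add_comm _ ((d 0 : ℂ) ^ 2)]
  · simp

/-- On the success outcome the operators map `|000⟩ + |111⟩` to a multiple of the target. -/
lemma sum_columns_eq (v b c : Fin 2 → EuclideanSpace ℂ (Fin 2)) (lam : ℝ) (d : Fin 2 → ℝ)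
    (k s r p x z : Fin 2) :
    ∑ j, attemptOp v lam d k (s + r) 0 p j * flipOp b k s x j * flipOp c k r z j =
      ((Real.sqrt (1 + lam) : ℂ)⁻¹ * 2⁻¹) * ∑ j, d j * (v j p * b j x * c j z) := by
  have h2 := ofReal_sqrt_inv_mul_self (x := 2) (by norm_num)
  push_cast at h2
  rw [Finset.mul_sum, ← Equiv.sum_comp (Equiv.addRight k)]
  refine Finset.sum_congr rfl fun j _ => ?_
  have hj : j + k + k = j := by fin_cases j <;> fin_cases k <;> rfl
  simp only [attemptOp, flipOp, if_true, Equiv.coe_addRight, hj]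
  rw [← h2]
  linear_combination ((Real.sqrt (1 + lam) : ℂ)⁻¹ * (Real.sqrt 2 : ℂ)⁻¹ ^ 2 * d j * v j p *
    b j x * c j z) * phase_add_mul s r j

lemma kron3_conjTranspose_mul_self_apply (A B C : Matrix (Fin 2) (Fin 2) ℂ)
    (p q : Fin 2 × Fin 2 × Fin 2) :
    ((kron3 A B C)ᴴ * kron3 A B C) p q =
      (Aᴴ * A) p.1 q.1 * (Bᴴ * B) p.2.1 q.2.1 * (Cᴴ * C) p.2.2 q.2.2 := by
  simp only [Matrix.mul_apply, Matrix.conjTranspose_apply, kron3, Fintype.sum_prod_type,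
    Fin.sum_univ_two, star_mul']
  ring

lemma toEuclideanLin_kron3_GHZ_apply (A B C : Matrix (Fin 2) (Fin 2) ℂ)
    (p : Fin 2 × Fin 2 × Fin 2) :
    Matrix.toEuclideanLin (kron3 A B C) GHZ p =
      (Real.sqrt 2 : ℂ)⁻¹ * ∑ j, A p.1 j * B p.2.1 j * C p.2.2 j := by
  simp [Matrix.toLpLin_apply, Matrix.mulVec, dotProduct, GHZ, tp3, ket, kron3,
    Fintype.sum_prod_type, Fin.sum_univ_two]
  ring

/-- Squared norm of the unnormalised target vector. -/
lemma norm_sq_superposition {a b c : Fin 2 → EuclideanSpace ℂ (Fin 2)} {lamA lamB lamC : ℝ}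
    (ha : HasOverlap a lamA) (hb : HasOverlap b lamB) (hc : HasOverlap c lamC) (α β : ℝ) :
    ‖(α : ℂ) • tp3 (a 0) (b 0) (c 0) + (β : ℂ) • tp3 (a 1) (b 1) (c 1)‖ ^ 2 =
      α ^ 2 + β ^ 2 + 2 * α * β * lamA * lamB * lamC := by
  have key (j l : Fin 2) : ⟪tp3 (a j) (b j) (c j), tp3 (a l) (b l) (c l)⟫_ℂ =
      (∑ i, star (a j i) * a l i) * (∑ i, star (b j i) * b l i) *
        (∑ i, star (c j i) * c l i) := by
    simp [PiLp.inner_apply, tp3, Fintype.sum_prod_type, Fin.sum_univ_two]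
    ring
  have : ((‖(α : ℂ) • tp3 (a 0) (b 0) (c 0) + (β : ℂ) • tp3 (a 1) (b 1) (c 1)‖ ^ 2 : ℝ) : ℂ) =
      ((α ^ 2 + β ^ 2 + 2 * α * β * lamA * lamB * lamC : ℝ) : ℂ) := by
    rw [Complex.ofReal_pow]
    refine (inner_self_eq_norm_sq_to_K (𝕜 := ℂ)
      ((α : ℂ) • tp3 (a 0) (b 0) (c 0) + (β : ℂ) • tp3 (a 1) (b 1) (c 1))).symm.trans ?_
    simp only [inner_add_left, inner_add_right, inner_smul_left, inner_smul_right, key,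
      ha _ _, hb _ _, hc _ _, Complex.conj_ofReal]
    simp
    ring
  exact_mod_cast this

/-- Reduction of the existence of a protocol to relations between matrix entries of the local
operators, in which the three parties play symmetric roles. -/
lemma exists_protocol {a1 a2 b1 b2 c1 c2 : EuclideanSpace ℂ (Fin 2)} {α β N t r : ℝ}
    (hN : ‖(α : ℂ) • tp3 a1 b1 c1 + (β : ℂ) • tp3 a2 b2 c2‖ ^ 2 = N)
    (hr : r ≠ 0) (ht : 0 ≤ t)
    (A B C : Fin 2 × Fin 2 × Fin 2 × Fin 2 → Matrix (Fin 2) (Fin 2) ℂ)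
    (hcomplete : ∀ p q x y z w, ∑ i, ((A i)ᴴ * A i) p q * ((B i)ᴴ * B i) x y *
      ((C i)ᴴ * C i) z w =
        (if p = q then 1 else 0) * (if x = y then 1 else 0) * (if z = w then 1 else 0))
    (hcol : ∀ k s u p x z, ∑ j, A (k, s, u, 0) p j * B (k, s, u, 0) x j * C (k, s, u, 0) z j =
      ((Real.sqrt t : ℂ)⁻¹ * 2⁻¹) *
        (α * (a1 p * b1 x * c1 z) + β * (a2 p * b2 x * c2 z))) :
    ∃ (m : ℕ) (A B C : Fin m → Matrix (Fin 2) (Fin 2) ℂ) (S : Finset (Fin m)),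
      (∑ i, (kron3 (A i) (B i) (C i))ᴴ * kron3 (A i) (B i) (C i) = 1)
      ∧ (∀ i ∈ S, ∃ e : ℂ, Matrix.toEuclideanLin (kron3 (A i) (B i) (C i)) GHZ =
          e • (r • ((α : ℂ) • tp3 a1 b1 c1 + (β : ℂ) • tp3 a2 b2 c2)))
      ∧ N / t ≤ ∑ i ∈ S, ‖Matrix.toEuclideanLin (kron3 (A i) (B i) (C i)) GHZ‖ ^ 2 := by
  set Φ := (α : ℂ) • tp3 a1 b1 c1 + (β : ℂ) • tp3 a2 b2 c2 with hΦ
  have hout (k s u : Fin 2) : Matrix.toEuclideanLin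
      (kron3 (A (k, s, u, 0)) (B (k, s, u, 0)) (C (k, s, u, 0))) GHZ =
        (((Real.sqrt 2)⁻¹ * ((Real.sqrt t)⁻¹ * 2⁻¹) : ℝ) : ℂ) • Φ := by
    ext p
    rw [toEuclideanLin_kron3_GHZ_apply, hcol]
    simp [hΦ, tp3]
    ring
  let e := Fintype.equivFin (Fin 2 × Fin 2 × Fin 2 × Fin 2)
  let T : Finset (Fin 2 × Fin 2 × Fin 2 × Fin 2) :=
    Finset.univ ×ˢ Finset.univ ×ˢ Finset.univ ×ˢ {0}
  refine ⟨_, A ∘ e.symm, B ∘ e.symm, C ∘ e.symm, T.map e.toEmbedding, ?_, ?_, ?_⟩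
  · simp only [Function.comp_apply]
    rw [Equiv.sum_comp e.symm
      (fun i => (kron3 (A i) (B i) (C i))ᴴ * kron3 (A i) (B i) (C i))]
    ext ⟨p, x, z⟩ ⟨q, y, w⟩
    simp only [Matrix.sum_apply, kron3_conjTranspose_mul_self_apply, hcomplete,
      Matrix.one_apply, Prod.mk.injEq]
    by_cases h₁ : p = q <;> by_cases h₂ : x = y <;> by_cases h₃ : z = w <;> simp [h₁, h₂, h₃]
  · intro i hi
    obtain ⟨⟨k, s, u, f⟩, hf, rfl⟩ := Finset.mem_map.1 hi
    obtain rfl : f = 0 := by simpa [T, eq_comm] using hf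
    refine ⟨(((Real.sqrt 2)⁻¹ * ((Real.sqrt t)⁻¹ * 2⁻¹) : ℝ) : ℂ) * (r : ℂ)⁻¹, ?_⟩
    have hr' : (r : ℂ) ≠ 0 := by exact_mod_cast hr
    simp only [Function.comp_apply, Equiv.coe_toEmbedding, Equiv.symm_apply_apply, hout]
    rw [← Complex.coe_smul r Φ, smul_smul, mul_assoc, inv_mul_cancel₀ hr', mul_one]
  · rw [Finset.sum_map]
    simp only [Function.comp_apply, Equiv.coe_toEmbedding, Equiv.symm_apply_apply, T,
      Finset.sum_product, Finset.sum_singleton, hout, norm_smul, mul_pow, hN,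
      Complex.norm_real, Real.norm_eq_abs, sq_abs, inv_pow, Real.sq_sqrt ht,
      Real.sq_sqrt (zero_le_two (α := ℝ)), Finset.sum_const, Finset.card_univ, Fintype.card_fin]
    apply le_of_eq
    simp only [nsmul_eq_mul]
    push_cast
    ring

/-- **Lemma 5 (lower bound via the four-step method).**
For `ψ = γ (α a₁⊗b₁⊗c₁ + β a₂⊗b₂⊗c₂)` with unit local vectors, real overlaps
`λ_a, λ_b, λ_c ∈ [0,1]`, `α, β > 0`, `α² + β² = 1` and
`γ = (1 + 2αβλ_aλ_bλ_c)^{-1/2}`, there is an LOCC protocol (complete product family)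
transforming `|GHZ⟩` into `ψ` with success probability at least
`(1 + 2αβλ_aλ_bλ_c)/(1 + min(λ_a, λ_b, λ_c))`. -/
theorem ghz_to_ghz_class_lower_bound
    (a1 a2 b1 b2 c1 c2 : EuclideanSpace ℂ (Fin 2))
    (ha1 : ‖a1‖ = 1) (ha2 : ‖a2‖ = 1) (hb1 : ‖b1‖ = 1) (hb2 : ‖b2‖ = 1)
    (hc1 : ‖c1‖ = 1) (hc2 : ‖c2‖ = 1)
    (lamA lamB lamC : ℝ)
    (hlamA : ⟪a1, a2⟫_ℂ = (lamA : ℂ)) (hlamB : ⟪b1, b2⟫_ℂ = (lamB : ℂ))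
    (hlamC : ⟪c1, c2⟫_ℂ = (lamC : ℂ))
    (hA : lamA ∈ Set.Icc (0 : ℝ) 1) (hB : lamB ∈ Set.Icc (0 : ℝ) 1)
    (hC : lamC ∈ Set.Icc (0 : ℝ) 1)
    (α β : ℝ) (hα : 0 < α) (hβ : 0 < β) (hnorm : α ^ 2 + β ^ 2 = 1)
    (ψ : EuclideanSpace ℂ (Fin 2 × Fin 2 × Fin 2))
    (hψ : ψ = ((1 + 2 * α * β * lamA * lamB * lamC : ℝ) ^ (-(1:ℝ)/2) : ℝ) •
        ((α : ℂ) • tp3 a1 b1 c1 + (β : ℂ) • tp3 a2 b2 c2)) :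
    ∃ (m : ℕ) (A B C : Fin m → Matrix (Fin 2) (Fin 2) ℂ) (S : Finset (Fin m)),
      (∑ i, (kron3 (A i) (B i) (C i))ᴴ * kron3 (A i) (B i) (C i) = 1)
      ∧ (∀ i ∈ S, ∃ c : ℂ, Matrix.toEuclideanLin (kron3 (A i) (B i) (C i)) GHZ = c • ψ)
      ∧ (1 + 2 * α * β * lamA * lamB * lamC) / (1 + min lamA (min lamB lamC))
          ≤ ∑ i ∈ S, ‖Matrix.toEuclideanLin (kron3 (A i) (B i) (C i)) GHZ‖ ^ 2 := by
  have ha := hasOverlap_of_inner ha1 ha2 hlamA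
  have hb := hasOverlap_of_inner hb1 hb2 hlamB
  have hc := hasOverlap_of_inner hc1 hc2 hlamC
  have hN : ‖(α : ℂ) • tp3 a1 b1 c1 + (β : ℂ) • tp3 a2 b2 c2‖ ^ 2 =
      1 + 2 * α * β * lamA * lamB * lamC := by
    rw [← hnorm]
    exact norm_sq_superposition ha hb hc α β
  have hpos : 0 < 1 + 2 * α * β * lamA * lamB * lamC := by
    have := hA.1
    have := hB.1
    have := hC.1
    positivity
  have hr := (Real.rpow_pos_of_pos hpos (-(1 : ℝ) / 2)).ne'
  have hd : (![α, β] : Fin 2 → ℝ) 0 ^ 2 + (![α, β] : Fin 2 → ℝ) 1 ^ 2 = 1 := by simpa using hnorm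
  subst hψ
  have hmin : min lamA (min lamB lamC) = lamA ∨ min lamA (min lamB lamC) = lamB ∨
      min lamA (min lamB lamC) = lamC := by
    grind
  rcases hmin with h | h | h <;> rw [h]
  · refine exists_protocol hN hr (by linarith [hA.1])
      (fun i => attemptOp ![a1, a2] lamA ![α, β] i.1 (i.2.1 + i.2.2.1) i.2.2.2)
      (fun i => flipOp ![b1, b2] i.1 i.2.1) (fun i => flipOp ![c1, c2] i.1 i.2.2.1)
      (fun p q x y z w => sum_gram_eq ha hb hc hA.1 hd p q x y z w)
      (fun k s u p x z => (sum_columns_eq _ _ _ _ _ k s u p x z).trans ?_)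
    simp [Fin.sum_univ_two]
  · refine exists_protocol hN hr (by linarith [hB.1])
      (fun i => flipOp ![a1, a2] i.1 i.2.1)
      (fun i => attemptOp ![b1, b2] lamB ![α, β] i.1 (i.2.1 + i.2.2.1) i.2.2.2)
      (fun i => flipOp ![c1, c2] i.1 i.2.2.1)
      (fun p q x y z w => ?_) (fun k s u p x z => ?_)
    · have := sum_gram_eq hb ha hc hB.1 hd x y p q z w
      refine Eq.trans (Finset.sum_congr rfl fun i _ => ?_) (this.trans ?_) <;> ring
    · have := sum_columns_eq ![b1, b2] ![a1, a2] ![c1, c2] lamB ![α, β] k s u x p z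
      refine Eq.trans (Finset.sum_congr rfl fun j _ => ?_) (this.trans ?_)
      · ring
      simp only [Fin.sum_univ_two, Matrix.cons_val_zero, Matrix.cons_val_one]
      ring
  · refine exists_protocol hN hr (by linarith [hC.1])
      (fun i => flipOp ![a1, a2] i.1 i.2.1) (fun i => flipOp ![b1, b2] i.1 i.2.2.1)
      (fun i => attemptOp ![c1, c2] lamC ![α, β] i.1 (i.2.1 + i.2.2.1) i.2.2.2)
      (fun p q x y z w => ?_) (fun k s u p x z => ?_)
    · have := sum_gram_eq hc ha hb hC.1 hd z w p q x y
      refine Eq.trans (Finset.sum_congr rfl fun i _ => ?_) (this.trans ?_) <;> ring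
    · have := sum_columns_eq ![c1, c2] ![a1, a2] ![b1, b2] lamC ![α, β] k s u z p x
      refine Eq.trans (Finset.sum_congr rfl fun j _ => ?_) (this.trans ?_)
      · ring
      simp only [Fin.sum_univ_two, Matrix.cons_val_zero, Matrix.cons_val_one]
      ring
end
end

section
/- Deterministic conversion of the generalized GHZ state under the orthogonality condition: let n ≥ 1 parties each hold ℂ^m with standard orthonormal basis e_1, …, e_m, let |GHZ_{m,n}⟩ = m^{−1/2}·∑_{i=1}^m e_i⊗⋯⊗e_i (n factors), and let ψ = ∑_{i=1}^m α_i·k_{1,i}⊗k_{2,i}⊗⋯⊗k_{n,i} be a unit vector with α_i > 0 and k_{j,i} ∈ ℂ^m unit vectors. Assume there exists p ∈ {1,…,m} such that for every i ≠ p there exists a party j ∈ {1,…,n} with ⟨k_{j,i}, k_{j,l}⟩ = 0 for all l ≠ i (i.e., for at least m−1 of the terms, some party's local state is orthogonal to that party's local state in every other term). Then there exists a finite family of n-tuples (A_{s,1},…,A_{s,n}) of linear maps on ℂ^m whose product operators O_s = A_{s,1}⊗⋯⊗A_{s,n} satisfy ∑_s O_s†O_s = 1 and such that every O_s|GHZ_{m,n}⟩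 is a complex scalar multiple of ψ; i.e., |GHZ_{m,n}⟩ can be transformed to ψ by LOCC with probability 1. -/
noncomputable section

open scoped InnerProductSpace
open Matrix

/-- The `n`-fold tensor product of vectors `k j ∈ ℂ^m` (party `j` holds `k j`),
realized inside `EuclideanSpace ℂ (Fin n → Fin m)`. -/
def tpN (n m : ℕ) (k : Fin n → EuclideanSpace ℂ (Fin m)) :
    EuclideanSpace ℂ (Fin n → Fin m) :=
  (WithLp.equiv 2 _).symm fun p => ∏ j, k j (p j)

/-- The product operator `A 1 ⊗ ⋯ ⊗ A n` on the `n`-party space, as a matrix. -/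
def kronN (n m : ℕ) (A : Fin n → Matrix (Fin m) (Fin m) ℂ) :
    Matrix (Fin n → Fin m) (Fin n → Fin m) ℂ :=
  fun p q => ∏ j, A j (p j) (q j)

/-- The generalized GHZ state `m^{-1/2} ∑ i, e_i ⊗ ⋯ ⊗ e_i` of `n` parties, each of
dimension `m`. -/
def GHZmn (n m : ℕ) : EuclideanSpace ℂ (Fin n → Fin m) :=
  (Real.sqrt m : ℂ)⁻¹ • ∑ i : Fin m, tpN n m fun _ => EuclideanSpace.single i 1

/-- The inner product of product vectors is the product of the local inner products. -/
theorem inner_tpN (n m : ℕ) (u v : Fin n → EuclideanSpace ℂ (Fin m)) :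
    ⟪tpN n m u, tpN n m v⟫_ℂ = ∏ j, ⟪u j, v j⟫_ℂ := by
  simp only [tpN, PiLp.inner_apply, WithLp.equiv_symm_apply, RCLike.inner_apply, map_prod,
    ← Finset.prod_mul_distrib]
  rw [Finset.prod_univ_sum, Fintype.piFinset_univ]

/-- The Gram matrix of a product operator is the product operator of the local Gram matrices. -/
theorem conjTranspose_kronN_mul_kronN (n m : ℕ) (A : Fin n → Matrix (Fin m) (Fin m) ℂ) :
    (kronN n m A)ᴴ * kronN n m A = kronN n m fun j => (A j)ᴴ * A j := by
  ext p q
  simp only [kronN, Matrix.mul_apply, Matrix.conjTranspose_apply, star_prod,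
    ← Finset.prod_mul_distrib]
  rw [Finset.prod_univ_sum, Fintype.piFinset_univ]

theorem toEuclideanLin_kronN_tpN_single (n m : ℕ) (A : Fin n → Matrix (Fin m) (Fin m) ℂ)
    (i : Fin m) :
    Matrix.toEuclideanLin (kronN n m A) (tpN n m fun _ => EuclideanSpace.single i 1) =
      tpN n m fun j => WithLp.toLp 2 fun r => A j r i := by
  ext p
  simp only [tpN, kronN, Matrix.toLpLin_apply, WithLp.equiv_symm_apply, Matrix.mulVec, dotProduct,
    ← Finset.prod_mul_distrib]
  rw [← Fintype.piFinset_univ,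
    ← Finset.prod_univ_sum (fun _ => Finset.univ)
      (fun j x => A j (p j) x * (EuclideanSpace.single i (1 : ℂ) : EuclideanSpace ℂ (Fin m)) x)]
  simp

theorem tpN_smul (n m : ℕ) (c : Fin n → ℂ) (u : Fin n → EuclideanSpace ℂ (Fin m)) :
    (tpN n m fun j => c j • u j) = (∏ j, c j) • tpN n m u := by
  ext p
  simp [tpN, Finset.prod_mul_distrib]

/-- Local sign patterns whose product over the parties is trivial for every basis label, so
that the corresponding diagonal product unitaries fix the GHZ state. -/
def ghzSigns (n m : ℕ) : Subgroup (Fin n → Fin m → ℤˣ) where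
  carrier := {ε | ∀ i, ∏ j, ε j i = 1}
  mul_mem' {a b} ha hb i := by simp [Finset.prod_mul_distrib, ha i, hb i]
  one_mem' i := by simp
  inv_mem' {a} ha i := by simp [ha i]

/-- The character by which diagonal signs act on the matrix unit with row `q` and column `q'`. -/
def signChar (n m : ℕ) (q q' : Fin n → Fin m) : (Fin n → Fin m → ℤˣ) →* ℤˣ where
  toFun ε := ∏ j, ε j (q j) * ε j (q' j)
  map_one' := by simp
  map_mul' a b := by
    rw [← Finset.prod_mul_distrib]
    exact Finset.prod_congr rfl fun j _ => mul_mul_mul_comm _ _ _ _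

theorem signChar_mulSingle (n m : ℕ) (q q' : Fin n → Fin m) (j : Fin n) (u : Fin m → ℤˣ) :
    signChar n m q q' (Pi.mulSingle j u) = u (q j) * u (q' j) := by
  change ∏ l, (Pi.mulSingle j u : Fin n → Fin m → ℤˣ) l (q l) *
    (Pi.mulSingle j u : Fin n → Fin m → ℤˣ) l (q' l) = _
  rw [Finset.prod_eq_single j]
  · simp
  · intro l _ hl
    simp [Pi.mulSingle_eq_of_ne hl]
  · simp

theorem mulSingle_mul_mulSingle_mem_ghzSigns (n m : ℕ) (j₀ j₁ : Fin n) (i : Fin m) :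
    (Pi.mulSingle j₀ (Pi.mulSingle i (-1)) * Pi.mulSingle j₁ (Pi.mulSingle i (-1)) :
      Fin n → Fin m → ℤˣ) ∈ ghzSigns n m := by
  intro l
  have h (j : Fin n) : ∏ x, (Pi.mulSingle j (Pi.mulSingle i (-1)) : Fin n → Fin m → ℤˣ) x l =
      (Pi.mulSingle i (-1) : Fin m → ℤˣ) l := by
    rw [Finset.prod_eq_single j]
    · simp
    · intro x _ hx
      simp [Pi.mulSingle_eq_of_ne hx]
    · simp
  simp only [Pi.mul_apply, Finset.prod_mul_distrib, h]
  exact Int.units_mul_self _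

theorem exists_mem_ghzSigns_signChar_eq_neg_one (n m : ℕ) (q q' : Fin n → Fin m) (j₀ j₁ : Fin n)
    (h₀ : q j₀ ≠ q' j₀) (h₁ : ¬ (q j₁ = q j₀ ∧ q' j₁ = q' j₀))
    (h₂ : ¬ (q j₁ = q' j₀ ∧ q' j₁ = q j₀)) :
    ∃ g ∈ ghzSigns n m, signChar n m q q' g = -1 := by
  have key (i : Fin m)
      (hi : (Pi.mulSingle i (-1) : Fin m → ℤˣ) (q j₀) *
        (Pi.mulSingle i (-1) : Fin m → ℤˣ) (q' j₀) *
        ((Pi.mulSingle i (-1) : Fin m → ℤˣ) (q j₁) *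
        (Pi.mulSingle i (-1) : Fin m → ℤˣ) (q' j₁)) = -1) :
      ∃ g ∈ ghzSigns n m, signChar n m q q' g = -1 :=
    ⟨_, mulSingle_mul_mulSingle_mem_ghzSigns n m j₀ j₁ i, by
      rw [map_mul, signChar_mulSingle, signChar_mulSingle, hi]⟩
  by_cases ha : (q j₁ = q j₀ ∨ q' j₁ = q j₀) ∧ q j₁ ≠ q' j₁
  · refine key (q' j₀) ?_
    simp only [Pi.mulSingle_apply]
    split_ifs <;> first | decide | grind
  · refine key (q j₀) ?_
    simp only [Pi.mulSingle_apply]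
    split_ifs <;> first | decide | grind

theorem sum_signChar_eq_zero (n m : ℕ) (q q' : Fin n → Fin m) [Fintype (ghzSigns n m)]
    (h : ∃ g ∈ ghzSigns n m, signChar n m q q' g = -1) :
    ∑ ε : ghzSigns n m, ((signChar n m q q' ε : ℤ) : ℂ) = 0 := by
  obtain ⟨g, hg, h⟩ := h
  have key := Equiv.sum_comp (Equiv.mulLeft (⟨g, hg⟩ : ghzSigns n m))
    fun ε => ((signChar n m q q' ε : ℤ) : ℂ)
  simp only [Equiv.coe_mulLeft, Subgroup.coe_mul, map_mul, h, Units.val_neg,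
    Int.cast_neg, neg_mul, one_mul, Finset.sum_neg_distrib] at key
  exact self_eq_neg.mp key.symm

/-- Twirling by the signs fixing the GHZ state kills every off-diagonal entry of a product of
local Gram matrices, provided distinct labels are orthogonal for some party. -/
theorem sum_signChar_mul_prod_inner (n m : ℕ) [Fintype (ghzSigns n m)]
    (k : Fin n → Fin m → EuclideanSpace ℂ (Fin m))
    (horth : ∀ a b, a ≠ b → ∃ j, ⟪k j a, k j b⟫_ℂ = 0) (q q' : Fin n → Fin m) (hq : q ≠ q') :
    (∑ ε : ghzSigns n m, ((signChar n m q q' ε : ℤ) : ℂ)) * ∏ j, ⟪k j (q j), k j (q' j)⟫_ℂ = 0 := by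
  obtain ⟨j₀, h₀⟩ := Function.ne_iff.mp hq
  obtain ⟨j₁, h₁⟩ := horth _ _ h₀
  by_cases h : ⟪k j₁ (q j₁), k j₁ (q' j₁)⟫_ℂ = 0
  · rw [Finset.prod_eq_zero (Finset.mem_univ j₁) h, mul_zero]
  · rw [sum_signChar_eq_zero, zero_mul]
    refine exists_mem_ghzSigns_signChar_eq_neg_one n m q q' j₀ j₁ h₀ ?_ ?_
    · rintro ⟨h₂, h₃⟩
      exact h (by rw [h₂, h₃, h₁])
    · rintro ⟨h₂, h₃⟩
      exact h (by rw [h₂, h₃, inner_eq_zero_symm, h₁])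

theorem sum_sq_eq_one_of_orthogonal (n m : ℕ) (α : Fin m → ℝ)
    (k : Fin n → Fin m → EuclideanSpace ℂ (Fin m)) (hk : ∀ j i, ‖k j i‖ = 1)
    (hψn : ‖∑ i : Fin m, (α i : ℂ) • tpN n m fun j => k j i‖ = 1)
    (horth : ∀ a b, a ≠ b → ∃ j, ⟪k j a, k j b⟫_ℂ = 0) :
    ∑ i, (α i : ℂ) ^ 2 = 1 := by
  have hon : Orthonormal ℂ fun i => tpN n m fun j => k j i := by
    rw [orthonormal_iff_ite]
    intro a b
    rw [inner_tpN]
    split_ifs with h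
    · subst h
      simp [inner_self_eq_norm_sq_to_K, hk]
    · obtain ⟨j, hj⟩ := horth a b h
      exact Finset.prod_eq_zero (Finset.mem_univ j) hj
  have h := hon.inner_sum (fun i => (α i : ℂ)) (fun i => (α i : ℂ)) Finset.univ
  rw [inner_self_eq_norm_sq_to_K, hψn] at h
  simpa [pow_two] using h.symm

/-- The local operator of party `j` sending `e_i` to `w j (i + s) * ε j i` times `k j (i + s)`. -/
def shiftOp (n m : ℕ) (w : Fin n → Fin m → ℂ)
    (k : Fin n → Fin m → EuclideanSpace ℂ (Fin m)) (s : Fin m) (ε : Fin n → Fin m → ℤˣ)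
    (j : Fin n) : Matrix (Fin m) (Fin m) ℂ :=
  Matrix.of fun r i => w j (i + s) * ((ε j i : ℤ) : ℂ) * k j (i + s) r

theorem conjTranspose_shiftOp_mul_apply (n m : ℕ) (w : Fin n → Fin m → ℂ)
    (k : Fin n → Fin m → EuclideanSpace ℂ (Fin m)) (s : Fin m) (ε : Fin n → Fin m → ℤˣ)
    (q q' : Fin n → Fin m) :
    ((kronN n m (shiftOp n m w k s ε))ᴴ * kronN n m (shiftOp n m w k s ε)) q q' =
      (∏ j, star (w j (q j + s)) * w j (q' j + s)) * (((signChar n m q q' ε : ℤ) : ℂ) *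
        ∏ j, ⟪k j (q j + s), k j (q' j + s)⟫_ℂ) := by
  rw [conjTranspose_kronN_mul_kronN]
  have h : ((signChar n m q q' ε : ℤ) : ℂ) =
      ∏ j, ((ε j (q j) : ℤ) : ℂ) * ((ε j (q' j) : ℤ) : ℂ) := by
    simp [signChar, Units.coe_prod]
  rw [h, ← Finset.prod_mul_distrib, ← Finset.prod_mul_distrib]
  refine Finset.prod_congr rfl fun j _ => ?_
  simp only [shiftOp, Matrix.mul_apply, Matrix.conjTranspose_apply, Matrix.of_apply,
    PiLp.inner_apply, RCLike.inner_apply, Finset.mul_sum]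
  refine Finset.sum_congr rfl fun r _ => ?_
  simp only [star_mul', RCLike.star_def, map_intCast]
  ring

theorem shiftOp_GHZmn (n m : ℕ) [NeZero m] (w : Fin n → Fin m → ℂ)
    (k : Fin n → Fin m → EuclideanSpace ℂ (Fin m)) (s : Fin m) (ε : Fin n → Fin m → ℤˣ)
    (hε : ε ∈ ghzSigns n m) :
    Matrix.toEuclideanLin (kronN n m (shiftOp n m w k s ε)) (GHZmn n m) =
      (Real.sqrt m : ℂ)⁻¹ • ∑ i, (∏ j, w j i) • tpN n m fun j => k j i := by
  rw [GHZmn, map_smul, map_sum,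
    ← Equiv.sum_comp (Equiv.addRight s) fun i => (∏ j, w j i) • tpN n m fun j => k j i]
  congr 1
  refine Finset.sum_congr rfl fun i _ => ?_
  have hcol (j : Fin n) : (WithLp.toLp 2 fun r => shiftOp n m w k s ε j r i) =
      (w j (i + s) * ((ε j i : ℤ) : ℂ)) • k j (i + s) := by
    ext r
    simp [shiftOp]
  have h1 : ∏ j, ((ε j i : ℤ) : ℂ) = 1 := by
    have := congrArg (fun u : ℤˣ => ((u : ℤ) : ℂ)) (hε i)
    simpa [Units.coe_prod] using this
  simp only [toEuclideanLin_kronN_tpN_single, hcol, tpN_smul, Finset.prod_mul_distrib, h1,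
    mul_one, Equiv.coe_addRight]

/-- **Theorem 9 (deterministic conversion of the generalized GHZ state under the
orthogonality condition).** If `ψ = ∑ i, αᵢ k_{1,i}⊗⋯⊗k_{n,i}` is a unit vector with
`αᵢ > 0`, unit local vectors, and there is a term `p` such that every other term `i ≠ p`
has some party `j` whose local state `k_{j,i}` is orthogonal to that party's local state
in every other term, then `|GHZ_{m,n}⟩` can be transformed into `ψ` by LOCC with
probability 1. -/
theorem generalized_ghz_deterministic_conversion
    (n m : ℕ) (hn : 1 ≤ n)
    (α : Fin m → ℝ) (hα : ∀ i, 0 < α i)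
    (k : Fin n → Fin m → EuclideanSpace ℂ (Fin m))
    (hk : ∀ j i, ‖k j i‖ = 1)
    (ψ : EuclideanSpace ℂ (Fin n → Fin m))
    (hψ : ψ = ∑ i : Fin m, (α i : ℂ) • tpN n m fun j => k j i)
    (hψn : ‖ψ‖ = 1)
    (horth : ∃ p : Fin m, ∀ i ≠ p, ∃ j : Fin n, ∀ l ≠ i, ⟪k j i, k j l⟫_ℂ = 0) :
    ∃ (N : ℕ) (A : Fin N → Fin n → Matrix (Fin m) (Fin m) ℂ),
      (∑ s, (kronN n m (A s))ᴴ * kronN n m (A s) = 1)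
      ∧ ∀ s, ∃ c : ℂ, Matrix.toEuclideanLin (kronN n m (A s)) (GHZmn n m) = c • ψ := by
  classical
  obtain ⟨p, hp⟩ := horth
  have horth' : ∀ a b, a ≠ b → ∃ j, ⟪k j a, k j b⟫_ℂ = 0 := by
    intro a b hab
    by_cases ha : a = p
    · obtain ⟨j, hj⟩ := hp b (fun hb => hab (ha.trans hb.symm))
      exact ⟨j, inner_eq_zero_symm.mp (hj a hab)⟩
    · obtain ⟨j, hj⟩ := hp a ha
      exact ⟨j, hj b hab.symm⟩
  have : NeZero m := ⟨by rintro rfl; exact p.elim0⟩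
  have : NeZero n := ⟨by omega⟩
  let _ : Fintype (ghzSigns n m) := Fintype.ofFinite _
  subst hψ
  have hsum := sum_sq_eq_one_of_orthogonal n m α k hk hψn horth'
  set C : ℕ := Fintype.card (ghzSigns n m) with hC
  have hC0 : (C : ℂ) ≠ 0 := Nat.cast_ne_zero.mpr Fintype.card_ne_zero
  have hsqrt : ((Real.sqrt C : ℝ) : ℂ) ^ 2 = C := by
    rw [← Complex.ofReal_pow, Real.sq_sqrt (Nat.cast_nonneg C), Complex.ofReal_natCast]
  let w : Fin n → Fin m → ℂ := fun j i => if j = 0 then (α i : ℂ) / (Real.sqrt C : ℝ) else 1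
  have hw (x : Fin n → Fin m) : ∏ j, w j (x j) = (α (x 0) : ℂ) / (Real.sqrt C : ℝ) := by
    simp [w]
  let e := (Fintype.equivFin (Fin m × ghzSigns n m)).symm
  refine ⟨_, fun t => shiftOp n m w k (e t).1 (e t).2, ?_, fun t => ?_⟩
  · rw [Equiv.sum_comp e fun x => (kronN n m (shiftOp n m w k x.1 x.2))ᴴ *
      kronN n m (shiftOp n m w k x.1 x.2), Fintype.sum_prod_type]
    ext q q'
    simp only [Matrix.sum_apply, conjTranspose_shiftOp_mul_apply, ← Finset.mul_sum,
      ← Finset.sum_mul]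
    by_cases hq : q = q'
    · subst hq
      have hchar (ε : ghzSigns n m) : signChar n m q q ε = 1 := by
        simp [signChar]
      have hs (s : Fin m) : ∏ j, star (w j (q j + s)) * w j (q j + s) =
          (α (q 0 + s) : ℂ) ^ 2 / C := by
        rw [Finset.prod_mul_distrib, ← star_prod, hw fun j => q j + s, ← hsqrt]
        simp only [star_div₀, RCLike.star_def, Complex.conj_ofReal]
        ring
      simp only [hchar, hs, inner_self_eq_norm_sq_to_K, hk]
      simp only [Units.val_one, Int.cast_one, Finset.sum_const, Finset.card_univ, ← hC,
        nsmul_eq_mul, mul_one, RCLike.ofReal_one, one_pow, Finset.prod_const_one,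
        div_mul_cancel₀ _ hC0, Matrix.one_apply_eq]
      rw [← hsum]
      exact Equiv.sum_comp (Equiv.addLeft (q 0)) fun i => (α i : ℂ) ^ 2
    · rw [Matrix.one_apply_ne hq]
      refine Finset.sum_eq_zero fun s _ => ?_
      rw [sum_signChar_mul_prod_inner n m (fun j i => k j (i + s))
        (fun a b hab => horth' _ _ fun h => hab (add_right_cancel h)) q q' hq, mul_zero]
  · refine ⟨(Real.sqrt m : ℂ)⁻¹ * ((Real.sqrt C : ℝ) : ℂ)⁻¹, ?_⟩
    rw [shiftOp_GHZmn n m w k _ _ (e t).2.2, mul_smul,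
      Finset.smul_sum (r := ((Real.sqrt C : ℝ) : ℂ)⁻¹)]
    congr 1
    refine Finset.sum_congr rfl fun i _ => ?_
    rw [hw fun _ => i, smul_smul, div_eq_inv_mul]
end
end

section
/- Deterministic adjustment of GHZ coefficients (generalized Nielsen/Lo–Popescu step): let n ≥ 1 parties each hold ℂ^m with standard orthonormal basis e_1, …, e_m, let |GHZ_{m,n}⟩ = m^{−1/2}·∑_{i=1}^m e_i⊗⋯⊗e_i (n factors), and let α_1, …, α_m ≥ 0 with ∑_{i=1}^m α_i² = 1. Then there exists a finite family of n-tuples (A_{s,1},…,A_{s,n}) of linear maps on ℂ^m whose product operators O_s = A_{s,1}⊗⋯⊗A_{s,n} satisfy ∑_s O_s†O_s = 1 and such that every O_s|GHZ_{m,n}⟩ is a complex scalar multiple of the GHZ-like state Ψ = ∑_{i=1}^m α_i·e_i⊗⋯⊗e_i; i.e., the uniform generalized GHZ state can be transformed into any GHZ-like (Schmidt decomposable) state of the same rank with probability 1. -/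
noncomputable section

open Matrix

/-- Cyclic shift `e_{i+s} ↦ e_i`, followed at party `j₀` by the diagonal matrix of the `α i`. -/
def shiftWeight {n m : ℕ} [NeZero m] (α : Fin m → ℝ) (j₀ : Fin n) (s : Fin m) (j : Fin n) :
    Matrix (Fin m) (Fin m) ℂ :=
  fun a b => (if j = j₀ then (α a : ℂ) else 1) * if b = a + s then 1 else 0

theorem kronN_shiftWeight {n m : ℕ} [NeZero m] (α : Fin m → ℝ) (j₀ : Fin n) (s : Fin m)
    (p q : Fin n → Fin m) :
    kronN n m (shiftWeight α j₀ s) p q =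
      if q = fun j => p j + s then (α (p j₀) : ℂ) else 0 := by
  simp only [kronN, shiftWeight, Finset.prod_ite_eq',
    Finset.mem_univ, if_true, Finset.prod_ite_zero, forall_const,
    funext_iff, mul_ite, mul_one, mul_zero]

theorem sum_conjTranspose_mul_kronN_shiftWeight {n m : ℕ} [NeZero m] (α : Fin m → ℝ)
    (hnorm : ∑ i, α i ^ 2 = 1) (j₀ : Fin n) :
    ∑ s, (kronN n m (shiftWeight α j₀ s))ᴴ * kronN n m (shiftWeight α j₀ s) = 1 := by
  ext q r
  have hterm (s : Fin m) :
      ((kronN n m (shiftWeight α j₀ s))ᴴ * kronN n m (shiftWeight α j₀ s)) q r =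
        if q = r then ((α (q j₀ - s) : ℂ)) ^ 2 else 0 := by
    rw [Matrix.mul_apply, Finset.sum_eq_single (fun j => q j - s)]
    · simp only [Matrix.conjTranspose_apply, kronN_shiftWeight, sub_add_cancel, if_true]
      split_ifs with h₁ h₂ h₂
      · simp [sq]
      · exact absurd h₁.symm h₂
      · exact absurd h₂.symm h₁
      · simp
    · intro p _ hp
      have hq : ¬ q = fun j => p j + s := by
        rintro rfl
        simp at hp
      simp [kronN_shiftWeight, hq]
    · simp
  rw [Matrix.sum_apply, Finset.sum_congr rfl fun s _ => hterm s, Matrix.one_apply]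
  split_ifs with h
  · refine (Equiv.sum_comp (Equiv.subLeft (q j₀)) fun i => (α i : ℂ) ^ 2).trans ?_
    exact_mod_cast hnorm
  · simp

theorem sum_smul_tpN_single_apply {n m : ℕ} (c : Fin m → ℂ) (p : Fin n → Fin m) :
    (∑ i, c i • tpN n m fun _ => EuclideanSpace.single i 1) p =
      ∑ i, if ∀ j, p j = i then c i else 0 := by
  simp [tpN, Finset.prod_ite_zero]

theorem GHZmn_apply {n m : ℕ} (p : Fin n → Fin m) :
    GHZmn n m p = (Real.sqrt m : ℂ)⁻¹ * ∑ i, if ∀ j, p j = i then 1 else 0 := by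
  rw [← sum_smul_tpN_single_apply]
  simp [GHZmn]

theorem toEuclideanLin_kronN_shiftWeight_GHZmn {n m : ℕ} [NeZero m] (α : Fin m → ℝ)
    (j₀ : Fin n) (s : Fin m) :
    Matrix.toEuclideanLin (kronN n m (shiftWeight α j₀ s)) (GHZmn n m) =
      (Real.sqrt m : ℂ)⁻¹ •
        ∑ i : Fin m, (α i : ℂ) • tpN n m fun _ => EuclideanSpace.single i 1 := by
  ext p
  have hshift : (∑ i, if ∀ j, p j + s = i then (1 : ℂ) else 0) =
      ∑ i, if ∀ j, p j = i then 1 else 0 := by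
    rw [← Equiv.sum_comp (Equiv.addRight s)]
    simp
  have hweight (i : Fin m) : (if ∀ j, p j = i then (α i : ℂ) else 0) =
      (α (p j₀) : ℂ) * if ∀ j, p j = i then 1 else 0 := by
    split_ifs with h
    · simp [h j₀]
    · simp
  rw [PiLp.smul_apply, sum_smul_tpN_single_apply, Finset.sum_congr rfl fun i _ => hweight i,
    ← Finset.mul_sum, Matrix.ofLp_toLpLin, Matrix.toLin'_apply]
  simp only [Matrix.mulVec, dotProduct, kronN_shiftWeight, ite_mul, zero_mul,
    Finset.sum_ite_eq', Finset.mem_univ, if_true, GHZmn_apply, hshift,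
    smul_eq_mul]
  ring

/-- **Deterministic adjustment of GHZ coefficients (generalized Nielsen / Lo–Popescu
step).** For any `α₁, …, α_m ≥ 0` with `∑ αᵢ² = 1`, the uniform generalized GHZ state
`|GHZ_{m,n}⟩` can be transformed by LOCC with probability 1 into the GHZ-like
(Schmidt decomposable) state `Ψ = ∑ i, αᵢ e_i⊗⋯⊗e_i`: there is a complete product
family every branch of which outputs a scalar multiple of `Ψ`. -/
theorem ghz_coefficients_adjustment_probability_one
    (n m : ℕ) (hn : 1 ≤ n)
    (α : Fin m → ℝ) (hα : ∀ i, 0 ≤ α i) (hnorm : ∑ i, α i ^ 2 = 1)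
    (Ψ : EuclideanSpace ℂ (Fin n → Fin m))
    (hΨ : Ψ = ∑ i : Fin m, (α i : ℂ) • tpN n m fun _ => EuclideanSpace.single i 1) :
    ∃ (N : ℕ) (A : Fin N → Fin n → Matrix (Fin m) (Fin m) ℂ),
      (∑ s, (kronN n m (A s))ᴴ * kronN n m (A s) = 1)
      ∧ ∀ s, ∃ c : ℂ, Matrix.toEuclideanLin (kronN n m (A s)) (GHZmn n m) = c • Ψ := by
  have : NeZero m := ⟨by rintro rfl; simp at hnorm⟩
  subst hΨ
  exact ⟨m, shiftWeight α ⟨0, hn⟩, sum_conjTranspose_mul_kronN_shiftWeight α hnorm _,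
    fun s => ⟨_, toEuclideanLin_kronN_shiftWeight_GHZmn α _ s⟩⟩
end
end

section
/- Attainability of the maximal 3-tangle at fixed interference term: for every a ∈ (0, 1), the parameter choice δ = π/4, α = β = γ = arccos(a), φ = 0 lies in the admissible ranges δ ∈ (0,π/4], α,β,γ ∈ (0,π/2], φ ∈ [0,2π), and yields t = a³, interference term I = t/(1+t) = a³/(1+a³), and 3-tangle τ = 4 sin²α sin²β sin²γ sin²δ cos²δ/(1+t)² = (1−a²)³/(1+a³)². Hence the upper bound (1−a²)³/(1+a³)² for the 3-tangle of a GHZ-class state with interference term I, where a is the real cube root of I/(1−I), is achieved, so it is the maximum. -/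
open Real

/-- **Attainability of the maximal 3-tangle at fixed interference term.**
For every `a ∈ (0,1)`, the parameter choice `δ = π/4`, `α = β = γ = arccos a`, `φ = 0`
lies in the admissible ranges `δ ∈ (0, π/4]`, `α, β, γ ∈ (0, π/2]`, `φ ∈ [0, 2π)`, and
yields `t = 2 cos α cos β cos γ sin δ cos δ cos φ = a³`, interference term
`I = t/(1+t) = a³/(1+a³)`, and 3-tangle
`τ = 4 sin²α sin²β sin²γ sin²δ cos²δ/(1+t)² = (1−a²)³/(1+a³)²`. Hence the upper bound
`(1−a²)³/(1+a³)²` for the 3-tangle at interference term `I` (with `a` the real cube root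
of `I/(1−I)`) is achieved. -/
theorem max_three_tangle_attained
    (a : ℝ) (ha : a ∈ Set.Ioo (0 : ℝ) 1)
    (δ α β γ φ t : ℝ)
    (hδ : δ = π / 4) (hαa : α = arccos a) (hβa : β = arccos a) (hγa : γ = arccos a)
    (hφ : φ = 0)
    (ht : t = 2 * cos α * cos β * cos γ * sin δ * cos δ * cos φ) :
    δ ∈ Set.Ioc 0 (π / 4)
    ∧ α ∈ Set.Ioc 0 (π / 2) ∧ β ∈ Set.Ioc 0 (π / 2) ∧ γ ∈ Set.Ioc 0 (π / 2)
    ∧ φ ∈ Set.Ico 0 (2 * π)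
    ∧ t = a ^ 3
    ∧ t / (1 + t) = a ^ 3 / (1 + a ^ 3)
    ∧ 4 * sin α ^ 2 * sin β ^ 2 * sin γ ^ 2 * sin δ ^ 2 * cos δ ^ 2 / (1 + t) ^ 2
        = (1 - a ^ 2) ^ 3 / (1 + a ^ 3) ^ 2 := by
  obtain ⟨ha0, ha1⟩ := ha
  have hcos : cos (arccos a) = a := cos_arccos (by linarith) ha1.le
  have hsin : sin (arccos a) ^ 2 = 1 - a ^ 2 := by rw [sin_sq, hcos]
  have hsin_quarter : sin (π / 4) ^ 2 = 1 / 2 := by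
    rw [sin_pi_div_four, div_pow, sq_sqrt zero_le_two]
    norm_num
  have hcos_quarter : cos (π / 4) ^ 2 = 1 / 2 := by
    rw [cos_sq', hsin_quarter]
    norm_num
  have hα : arccos a ∈ Set.Ioc 0 (π / 2) :=
    ⟨arccos_pos.2 ha1, arccos_le_pi_div_two.2 ha0.le⟩
  have hta : t = a ^ 3 := by
    rw [ht, hαa, hβa, hγa, hδ, hφ, hcos, cos_zero, sin_pi_div_four, ← cos_pi_div_four]
    linear_combination 2 * a ^ 3 * hcos_quarter
  subst hδ hαa hβa hγa hφ
  refine ⟨⟨by positivity, le_rfl⟩, hα, hα, hα, ⟨le_rfl, by positivity⟩, hta, by rw [hta], ?_⟩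
  rw [hta, hsin, hsin_quarter, hcos_quarter]
  ring
end
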